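/- arXiv:1203.5622 — 5 statements merged into one kernel-verified Lean document; each statement's English description precedes it below -/
import Mathlib

section
/- Let (A, A₊, u_A) be an abstract state space whose set of normalized states Ω_A is a polytope. Suppose that for every pure effect f (every extreme point f of E_A) there exists a linear map T : A → A such that T(A₊) ⊆ A₊, u_A ∘ T = f, and T(ω) = ω for every ω ∈ Ω_A with f(ω) = 1. Then Ω_A is a simplex, i.e. the set of extreme points of Ω_A is affinely independent and Ω_A is its convex hull. -/
open Set

variable {A : Type*} [NormedAddCommGroup A] [NormedSpace ℝ A] [FiniteDimensional ℝ A]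

/-- The set of normalized states of an abstract state space `(A, Apos, u)`. -/
def states (Apos : Set A) (u : Module.Dual ℝ A) : Set A :=
  {ω | ω ∈ Apos ∧ u ω = 1}

/-- The set of effects of an abstract state space `(A, Apos, u)`. -/
def effects (Apos : Set A) (u : Module.Dual ℝ A) : Set (Module.Dual ℝ A) :=
  {f | ∀ ω ∈ states Apos u, 0 ≤ f ω ∧ f ω ≤ 1}

/-- Given a finite spanning set `V` and a functional that is nonnegative on `V` and positive at `v`,
there is such a functional whose kernel is moreover spanned by its zeros in `V`. -/
theorem exists_nonneg_on_ker_le_span {E : Type*} [AddCommGroup E] [Module ℝ E]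
    (V : Finset E) (hspan : Submodule.span ℝ (V : Set E) = ⊤) (v : E)
    (f₀ : Module.Dual ℝ E) (hf₀ : ∀ w ∈ V, 0 ≤ f₀ w) (hv₀ : 0 < f₀ v) :
    ∃ f : Module.Dual ℝ E, (∀ w ∈ V, 0 ≤ f w) ∧ 0 < f v ∧
      LinearMap.ker f ≤ Submodule.span ℝ {w | w ∈ V ∧ f w = 0} := by
  classical
  obtain ⟨f, ⟨hf, hfv⟩, hmin⟩ := (measure fun f : Module.Dual ℝ E =>
    (V.filter fun w => f w ≠ 0).card).wf.has_min
      {f | (∀ w ∈ V, 0 ≤ f w) ∧ 0 < f v} ⟨f₀, hf₀, hv₀⟩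
  refine ⟨f, hf, hfv, fun x hx => ?_⟩
  rw [LinearMap.mem_ker] at hx
  by_contra hxS
  have hx' : x ∉ Submodule.span ℝ (insert v {w | w ∈ V ∧ f w = 0}) := by
    intro h
    obtain ⟨c, s, hs, rfl⟩ := Submodule.mem_span_insert.1 h
    have hfs : f s = 0 := by
      have : Submodule.span ℝ {w | w ∈ V ∧ f w = 0} ≤ LinearMap.ker f :=
        Submodule.span_le.2 fun w hw => hw.2
      exact this hs
    have hc : c = 0 := by
      simpa [hfs, hfv.ne'] using hx
    exact hxS (by simpa [hc] using hs)
  obtain ⟨g, hgx, hg⟩ := Submodule.exists_le_ker_of_notMem hx'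
  have hgv : g v = 0 := hg (Submodule.subset_span (mem_insert _ _))
  have hgZ : ∀ w ∈ V, f w = 0 → g w = 0 := fun w hw h =>
    hg (Submodule.subset_span (mem_insert_of_mem _ ⟨hw, h⟩))
  obtain ⟨g, hgv, hgZ, w₀, hw₀, hgw₀⟩ : ∃ g : Module.Dual ℝ E, g v = 0 ∧
      (∀ w ∈ V, f w = 0 → g w = 0) ∧ ∃ w ∈ V, g w < 0 := by
    by_cases h : ∃ w ∈ V, g w < 0
    · exact ⟨g, hgv, hgZ, h⟩
    · push Not at h
      refine ⟨-g, by simp [hgv], fun w hw h => by simp [hgZ w hw h], ?_⟩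
      by_contra! h'
      refine hgx ?_
      have : Submodule.span ℝ (V : Set E) ≤ LinearMap.ker g := Submodule.span_le.2 fun w hw =>
        le_antisymm (by simpa using h' w hw) (h w hw)
      rw [hspan] at this
      exact this Submodule.mem_top
  obtain ⟨w₁, hw₁, hw₁min⟩ := (V.filter fun w => g w < 0).exists_min_image
    (fun w => f w / -g w) ⟨w₀, Finset.mem_filter.2 ⟨hw₀, hgw₀⟩⟩
  rw [Finset.mem_filter] at hw₁
  set t := f w₁ / -g w₁ with ht
  have hfw₁ : f w₁ ≠ 0 := fun h => hw₁.2.ne (hgZ w₁ hw₁.1 h)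
  have ht0 : 0 ≤ t := div_nonneg (hf _ hw₁.1) (by linarith [hw₁.2])
  have hzero : f w₁ + t * g w₁ = 0 := by
    have := hw₁.2.ne
    rw [ht]
    field_simp
    ring
  refine hmin (f + t • g) ⟨fun w hw => ?_, by simpa [hgv] using hfv⟩ ?_
  · rcases lt_or_ge (g w) 0 with h | h
    · have := hw₁min w (Finset.mem_filter.2 ⟨hw, h⟩)
      rw [le_div_iff₀ (by linarith)] at this
      simp only [LinearMap.add_apply, LinearMap.smul_apply, smul_eq_mul]
      linarith
    · have := mul_nonneg ht0 h
      simpa using add_nonneg (hf w hw) this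
  · refine Finset.card_lt_card (Finset.ssubset_iff_of_subset ?_ |>.2 ⟨w₁, ?_, ?_⟩)
    · intro w hw
      rw [Finset.mem_filter] at hw ⊢
      exact ⟨hw.1, fun h => hw.2 (by simp [h, hgZ w hw.1 h])⟩
    · exact Finset.mem_filter.2 ⟨hw₁.1, hfw₁⟩
    · simp [hzero]

/-- A family of points with a dual family of functionals is affinely independent. -/
theorem affineIndependent_of_dual {ι E : Type*} [AddCommGroup E] [Module ℝ E] (p : ι → E)
    (h : ∀ i, ∃ f : Module.Dual ℝ E, f (p i) ≠ 0 ∧ ∀ j ≠ i, f (p j) = 0) :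
    AffineIndependent ℝ p := by
  have hli : LinearIndependent ℝ p := by
    rw [linearIndependent_iff']
    intro s c hc i hi
    obtain ⟨f, hfi, hf⟩ := h i
    have := congrArg f hc
    rw [map_sum, Finset.sum_eq_single_of_mem i hi fun j _ hj => by simp [hf j hj]] at this
    simpa [hfi] using this
  exact hli.affineIndependent

/-- If `f` has maximum `1` on the states and its kernel is spanned by states, then the complementary
effect `u - f` is pure. -/
theorem sub_mem_extremePoints_effects {E : Type*} [NormedAddCommGroup E] [NormedSpace ℝ E]
    (Apos : Set E) (u f : Module.Dual ℝ E) (hf : f ∈ effects Apos u) {w : E} (hw : w ∈ states Apos u) (hfw : f w = 1)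
    (hker : LinearMap.ker f ≤ Submodule.span ℝ {ω | ω ∈ states Apos u ∧ f ω = 0}) :
    u - f ∈ Set.extremePoints ℝ (effects Apos u) := by
  refine ⟨fun ω hω => ?_, ?_⟩
  · have := hf ω hω
    simp only [LinearMap.sub_apply, hω.2]
    constructor <;> linarith
  intro h₁ hh₁ h₂ hh₂ ⟨a, b, ha, hb, hab, hsum⟩
  have hsum' : ∀ x, a * h₁ x + b * h₂ x = u x - f x := fun x => by
    simpa using LinearMap.congr_fun hsum x
  have hker₁ : LinearMap.ker f ≤ LinearMap.ker (u - h₁) := by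
    refine hker.trans (Submodule.span_le.2 fun ω hω => ?_)
    have h := hsum' ω
    rw [hω.1.2, hω.2] at h
    have := (hh₁ ω hω.1).2
    have := (hh₂ ω hω.1).2
    have : h₁ ω = 1 := by nlinarith
    simp [hω.1.2, this]
  have hw₁ : h₁ w = 0 := by
    have h := hsum' w
    rw [hw.2, hfw] at h
    have := (hh₁ w hw).1
    have := mul_nonneg hb.le (hh₂ w hw).1
    nlinarith
  ext x
  have hx : x - f x • w ∈ LinearMap.ker f := by simp [hfw]
  have := hker₁ hx
  simp only [LinearMap.mem_ker, LinearMap.sub_apply, map_sub, map_smul, hw.2, hw₁,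
    smul_eq_mul] at this
  simp only [LinearMap.sub_apply]
  linarith

/-- If the set of normalized states of an abstract state space is a polytope
and every pure effect `f` admits a linear transformation `T` with `T(A₊) ⊆ A₊`, `u ∘ T = f`
and `T ω = ω` whenever `f ω = 1`, then the set of normalized states is a simplex. -/
theorem polytopic_with_nondisturbing_measurements_is_simplex
    (Apos : Set A) (u : Module.Dual ℝ A)
    (hclosed : IsClosed Apos)
    (hadd : ∀ x ∈ Apos, ∀ y ∈ Apos, x + y ∈ Apos)
    (hsmul : ∀ x ∈ Apos, ∀ c : ℝ, 0 ≤ c → c • x ∈ Apos)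
    (hpointed : ∀ x ∈ Apos, -x ∈ Apos → x = 0)
    (hgen : ∀ x : A, ∃ y ∈ Apos, ∃ z ∈ Apos, x = y - z)
    (hu : ∀ x ∈ Apos, x ≠ 0 → 0 < u x)
    (hcpt : IsCompact (states Apos u))
    (hfin : (Set.extremePoints ℝ (states Apos u)).Finite)
    (hT : ∀ f ∈ Set.extremePoints ℝ (effects Apos u),
      ∃ T : A →ₗ[ℝ] A, (∀ x ∈ Apos, T x ∈ Apos) ∧ u.comp T = f ∧
        ∀ ω ∈ states Apos u, f ω = 1 → T ω = ω) :
    AffineIndependent ℝ (fun e : Set.extremePoints ℝ (states Apos u) => (e : A)) ∧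
      states Apos u = convexHull ℝ (Set.extremePoints ℝ (states Apos u)) := by
  have hconv : Convex ℝ (states Apos u) := by
    intro x hx y hy a b ha hb hab
    exact ⟨hadd _ (hsmul _ hx.1 _ ha) _ (hsmul _ hy.1 _ hb), by simp [hx.2, hy.2, hab]⟩
  have hhull : states Apos u = convexHull ℝ (Set.extremePoints ℝ (states Apos u)) := by
    conv_lhs => rw [← closure_convexHull_extremePoints hcpt hconv]
    exact (hfin.isClosed_convexHull ℝ).closure_eq
  refine ⟨affineIndependent_of_dual _ fun ⟨v, hv⟩ => ?_, hhull⟩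
  have hnormalize : ∀ x ∈ Apos, x ≠ 0 → (u x)⁻¹ • x ∈ states Apos u := fun x hx hx0 => by
    have := hu x hx hx0
    exact ⟨hsmul x hx _ (inv_nonneg.2 this.le), by simp [this.ne']⟩
  have hspan : Submodule.span ℝ (hfin.toFinset : Set A) = ⊤ := by
    rw [Set.Finite.coe_toFinset, Submodule.eq_top_iff']
    have hmem : ∀ x ∈ Apos, x ∈ Submodule.span ℝ (Set.extremePoints ℝ (states Apos u)) := by
      intro x hx
      rcases eq_or_ne x 0 with rfl | hx0
      · exact Submodule.zero_mem _
      have h := hnormalize x hx hx0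
      rw [hhull] at h
      have := Submodule.smul_mem _ (u x) (convexHull_min Submodule.subset_span (Submodule.convex _) h)
      rwa [smul_inv_smul₀ (hu x hx hx0).ne'] at this
    intro x
    obtain ⟨y, hy, z, hz, rfl⟩ := hgen x
    exact Submodule.sub_mem _ (hmem y hy) (hmem z hz)
  obtain ⟨f, hf, hfv, hker⟩ := exists_nonneg_on_ker_le_span hfin.toFinset hspan v u
    (fun w hw => by simp [((hfin.mem_toFinset).1 hw).1.2]) (by simp [hv.1.2])
  simp only [Set.Finite.mem_toFinset] at hf hker
  obtain ⟨w, hw, hwmax⟩ := hfin.exists_maximalFor f _ ⟨v, hv⟩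
  replace hwmax : ∀ x ∈ Set.extremePoints ℝ (states Apos u), f x ≤ f w := fun x hx =>
    (le_total (f w) (f x)).elim (fun h => hwmax hx h) id
  have hfw : 0 < f w := hfv.trans_le (hwmax v hv)
  -- rescale so that the maximum is `1`
  obtain ⟨f, hf, hfv, hwmax, hfw, hker⟩ : ∃ f : Module.Dual ℝ A,
      (∀ x ∈ Set.extremePoints ℝ (states Apos u), 0 ≤ f x) ∧ 0 < f v ∧
      (∀ x ∈ Set.extremePoints ℝ (states Apos u), f x ≤ 1) ∧ f w = 1 ∧
      LinearMap.ker f ≤ Submodule.span ℝ {ω | ω ∈ states Apos u ∧ f ω = 0} := by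
    refine ⟨(f w)⁻¹ • f, fun x hx => ?_, ?_, fun x hx => ?_, ?_, fun x hx => ?_⟩
    · exact mul_nonneg (inv_nonneg.2 hfw.le) (hf x hx)
    · exact mul_pos (inv_pos.2 hfw) hfv
    · exact (inv_mul_le_one₀ hfw).2 (hwmax x hx)
    · exact inv_mul_cancel₀ hfw.ne'
    · have hx' : f x = 0 := by simpa [hfw.ne'] using hx
      refine Submodule.span_mono ?_ (hker hx')
      exact fun ω hω => ⟨hω.1.1, by simp [hω.2]⟩
  have heff : f ∈ effects Apos u := by
    have : states Apos u ⊆ f ⁻¹' Set.Icc 0 1 := by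
      rw [hhull]
      exact convexHull_min (fun x hx => Set.mem_preimage.2 ⟨hf x hx, hwmax x hx⟩)
        ((convex_Icc (0 : ℝ) 1).linear_preimage f)
    exact this
  obtain ⟨T, hTpos, hTu, hTfix⟩ := hT _ (sub_mem_extremePoints_effects Apos u f heff hw.1 hfw hker)
  have hTu' : ∀ x, u (T x) = u x - f x := LinearMap.congr_fun hTu
  have hTker : ∀ x, f x = 0 → T x = x := by
    have : LinearMap.ker f ≤ LinearMap.eqLocus T LinearMap.id :=
      hker.trans (Submodule.span_le.2 fun ω hω =>
        hTfix ω hω.1 (by simp [hω.1.2, hω.2]))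
    exact this
  have hzero : ∀ x ∈ Apos, u x = 0 → x = 0 := fun x hx h => by
    by_contra hx0
    exact (hu x hx hx0).ne' h
  have hTw : T w = 0 := hzero _ (hTpos _ hw.1.1) (by simp [hTu', hw.1.2, hfw])
  have hunique : ∀ x ∈ Set.extremePoints ℝ (states Apos u), 0 < f x → x = w := by
    intro x hx hfx
    have hTx : T x = x - f x • w := by
      have := hTker (x - f x • w) (by simp [hfw])
      simpa [hTw] using this
    have huTx : u (T x) = 1 - f x := by rw [hTu', hx.1.2]
    rcases (hwmax x hx).eq_or_lt with h | h
    · have := hzero _ (hTpos x hx.1.1) (by rw [huTx, h, sub_self])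
      rw [hTx, h, one_smul] at this
      exact sub_eq_zero.1 this
    · have h1 : 0 < 1 - f x := by linarith
      have hy := hnormalize (T x) (hTpos x hx.1.1) (by
        intro h0
        rw [h0, map_zero] at huTx
        linarith)
      rw [huTx] at hy
      refine (hx.2 hw.1 hy ⟨f x, 1 - f x, hfx, h1, by ring, ?_⟩).symm
      rw [smul_inv_smul₀ h1.ne', hTx]
      abel
  refine ⟨f, hfv.ne', fun ⟨x, hx⟩ hxv => ?_⟩
  by_contra h
  have hpos := (hf x hx).lt_of_ne' h
  exact hxv (Subtype.ext ((hunique x hx hpos).trans (hunique v hv hfv).symm))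
end

section
/- Let (A, A₊, u_A) be an abstract state space whose set of normalized states Ω_A is a polytope. Suppose that for every pure effect f (every extreme point f of E_A) there exists a linear map T : A → A such that T(A₊) ⊆ A₊, u_A ∘ T = f, and T(ω) = ω for every ω ∈ Ω_A with f(ω) = 1. Then Ω_A is uniformly pyramidal: for every facet F of Ω_A there exists a point a ∈ Ω_A such that Ω_A is the convex hull of F ∪ {a}. -/
open Set

variable {A : Type*} [NormedAddCommGroup A] [NormedSpace ℝ A] [FiniteDimensional ℝ A]

/-- `F` is a face of the convex set `C`. -/
def IsFace (C F : Set A) : Prop :=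
  F.Nonempty ∧ Convex ℝ F ∧ F ⊆ C ∧
    ∀ x ∈ C, ∀ y ∈ C, ∀ α : ℝ, 0 < α → α < 1 → α • x + (1 - α) • y ∈ F → x ∈ F ∧ y ∈ F

/-- The dimension of a subset of a vector space: the dimension of its affine hull. -/
noncomputable def setDim (s : Set A) : ℕ := Module.finrank ℝ (affineSpan ℝ s).direction

/-- A linear map that is constant on a set kills the directions of that set. -/
theorem vectorSpan_le_ker {V W : Type*} [AddCommGroup V] [Module ℝ V] [AddCommGroup W]
    [Module ℝ W] {s : Set V} (L : V →ₗ[ℝ] W) (b : W) (h : ∀ x ∈ s, L x = b) :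
    vectorSpan ℝ s ≤ LinearMap.ker L := by
  rw [vectorSpan_def, Submodule.span_le]
  rintro _ ⟨x, hx, y, hy, rfl⟩
  simp [h x hx, h y hy]

/-- A point in the relative interior of a convex set can be pushed slightly beyond,
away from any point of the affine span. -/
theorem exists_pushed_mem {V : Type*} [NormedAddCommGroup V] [NormedSpace ℝ V] {s : Set V}
    {p z : V} (hp : p ∈ intrinsicInterior ℝ s) (hz : z ∈ affineSpan ℝ s) :
    ∃ t : ℝ, 0 < t ∧ AffineMap.lineMap p z (-t) ∈ s := by
  obtain ⟨q, hq, rfl⟩ := mem_intrinsicInterior.1 hp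
  let γ : ℝ → affineSpan ℝ s := fun t =>
    ⟨AffineMap.lineMap (q : V) z (-t), AffineMap.lineMap_mem _ q.2 hz⟩
  have hγ : Continuous γ := by
    refine Continuous.subtype_mk ?_ _
    exact AffineMap.lineMap_continuous.comp continuous_neg
  have h0 : γ 0 = q := by ext; simp [γ]
  have hnhds : ∀ᶠ t in nhds (0 : ℝ), γ t ∈ interior ((↑) ⁻¹' s : Set (affineSpan ℝ s)) :=
    hγ.continuousAt.eventually_mem (by rw [h0]; exact isOpen_interior.mem_nhds hq)
  obtain ⟨ε, hε, hball⟩ := Metric.eventually_nhds_iff.1 hnhds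
  refine ⟨ε / 2, by positivity, ?_⟩
  have := hball (y := ε / 2) (by simp [abs_of_pos hε, hε])
  exact interior_subset (s := ((↑) ⁻¹' s : Set (affineSpan ℝ s))) this

/-- A face contains every point of the ambient convex set that lies in its affine span. -/
theorem IsFace.mem_of_mem_affineSpan {C F : Set A} (hF : IsFace C F) {z : A} (hzC : z ∈ C)
    (hz : z ∈ affineSpan ℝ F) : z ∈ F := by
  obtain ⟨p, hp⟩ := hF.1.intrinsicInterior hF.2.1
  obtain ⟨t, ht, hw⟩ := exists_pushed_mem hp hz
  refine (hF.2.2.2 z hzC _ (hF.2.2.1 hw) (t / (1 + t)) (by positivity)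
    ((div_lt_one (by positivity)).2 (by linarith)) ?_).1
  convert intrinsicInterior_subset hp using 1
  rw [AffineMap.lineMap_apply_module]
  have h1 : (1 + t) ≠ 0 := by positivity
  match_scalars <;> field_simp <;> ring

/-- A facet of a convex set contained in `{u = 1}` is cut out by a linear functional that is
nonnegative on the set. -/
theorem exists_facet_functional {C F : Set A} (hC : Convex ℝ C) (hF : IsFace C F)
    (hdim : setDim F + 1 = setDim C) (u : Module.Dual ℝ A) (hu : ∀ x ∈ C, u x = 1) :
    ∃ g : Module.Dual ℝ A, (∀ x ∈ F, g x = 0) ∧ (∀ x ∈ C, 0 ≤ g x) ∧ (∃ x ∈ C, 0 < g x) ∧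
      ∀ e ∈ vectorSpan ℝ C, g e = 0 → e ∈ vectorSpan ℝ F := by
  obtain ⟨p, hp⟩ := hF.1
  have hpC := hF.2.2.1 hp
  have hle : vectorSpan ℝ F ≤ vectorSpan ℝ C := vectorSpan_mono ℝ hF.2.2.1
  have hfinrank : Module.finrank ℝ (vectorSpan ℝ F) + 1 = Module.finrank ℝ (vectorSpan ℝ C) := by
    rw [← direction_affineSpan, ← direction_affineSpan]
    exact hdim
  obtain ⟨w, hw, hwp⟩ : ∃ w ∈ C, w - p ∉ vectorSpan ℝ F := by
    by_contra! h
    have : vectorSpan ℝ C ≤ vectorSpan ℝ F := by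
      rw [vectorSpan_eq_span_vsub_set_right ℝ hpC, Submodule.span_le]
      rintro _ ⟨x, hx, rfl⟩
      exact h x hx
    have := Submodule.finrank_mono this
    omega
  have hw_notMem : w ∉ vectorSpan ℝ F ⊔ Submodule.span ℝ {p} := by
    intro h
    obtain ⟨d, hd, _, hy, hdy⟩ := Submodule.mem_sup.1 h
    obtain ⟨c, rfl⟩ := Submodule.mem_span_singleton.1 hy
    have hud : u d = 0 := vectorSpan_le_ker u 1 (fun x hx => hu x (hF.2.2.1 hx)) hd
    have hc : c = 1 := by
      have := congrArg u hdy
      simpa [hud, hu p hpC, hu w hw] using this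
    apply hwp
    rw [← hdy, hc]
    simpa using hd
  obtain ⟨g₀, hg₀w, hg₀⟩ := Submodule.exists_le_ker_of_notMem hw_notMem
  obtain ⟨g, hgw, hg⟩ : ∃ g : Module.Dual ℝ A, 0 < g w ∧
      vectorSpan ℝ F ⊔ Submodule.span ℝ {p} ≤ LinearMap.ker g := by
    refine ⟨(g₀ w)⁻¹ • g₀, by simp [hg₀w], fun x hx => ?_⟩
    have := hg₀ hx
    simp_all
  have hgp : g p = 0 := hg (Submodule.mem_sup_right (Submodule.mem_span_singleton_self p))
  have hgd : ∀ d ∈ vectorSpan ℝ F, g d = 0 := fun d hd => hg (Submodule.mem_sup_left hd)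
  have hker : ∀ e ∈ vectorSpan ℝ C, g e = 0 → e ∈ vectorSpan ℝ F := by
    have hlt : vectorSpan ℝ C ⊓ LinearMap.ker g < vectorSpan ℝ C := by
      refine lt_of_le_of_ne inf_le_left fun h => ?_
      have : w - p ∈ vectorSpan ℝ C := vsub_mem_vectorSpan ℝ hw hpC
      rw [← h] at this
      have := this.2
      simp [hgp] at this
      exact hgw.ne' this
    have hfr := Submodule.finrank_lt_finrank_of_lt hlt
    have heq : vectorSpan ℝ F = vectorSpan ℝ C ⊓ LinearMap.ker g :=
      Submodule.eq_of_le_of_finrank_le (le_inf hle fun d hd => hgd d hd) (by omega)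
    intro e he hge
    rw [heq]
    exact ⟨he, hge⟩
  have hgF : ∀ x ∈ F, g x = 0 := by
    intro x hx
    have := hgd _ (vsub_mem_vectorSpan ℝ hx hp)
    simpa [hgp] using this
  refine ⟨g, hgF, fun y hy => ?_, ⟨w, hw, hgw⟩, hker⟩
  by_contra! hneg
  have hpos : 0 < g w - g y := by linarith
  set α := -g y / (g w - g y) with hα
  have hα0 : 0 < α := div_pos (by linarith) hpos
  have hα1 : α < 1 := (div_lt_one hpos).2 (by linarith)
  have hzC : α • w + (1 - α) • y ∈ C := hC hw hy hα0.le (by linarith) (by ring)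
  have hgz : g (α • w + (1 - α) • y) = 0 := by
    simp only [map_add, map_smul, smul_eq_mul, hα]
    field_simp
    ring
  have hz : α • w + (1 - α) • y ∈ affineSpan ℝ F := by
    have h := hker _ (vsub_mem_vectorSpan ℝ hzC hpC) (by simpa [hgp] using hgz)
    rw [← direction_affineSpan] at h
    simpa using AffineSubspace.vadd_mem_of_mem_direction h (subset_affineSpan ℝ F hp)
  have := hF.2.2.2 w hw y hy α hα0 hα1 (hF.mem_of_mem_affineSpan hzC hz)
  exact hgw.ne' (hgF w this.1)

/-- If the set of normalized states of an abstract state space is a polytope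
and every pure effect `f` admits a linear transformation `T` with `T(A₊) ⊆ A₊`, `u ∘ T = f`
and `T ω = ω` whenever `f ω = 1`, then the set of normalized states is uniformly pyramidal:
each facet `F` has an apex `a` with `Ω_A = conv (F ∪ {a})`. -/
theorem polytopic_with_nondisturbing_measurements_is_uniformly_pyramidal
    (Apos : Set A) (u : Module.Dual ℝ A)
    (hclosed : IsClosed Apos)
    (hadd : ∀ x ∈ Apos, ∀ y ∈ Apos, x + y ∈ Apos)
    (hsmul : ∀ x ∈ Apos, ∀ c : ℝ, 0 ≤ c → c • x ∈ Apos)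
    (hpointed : ∀ x ∈ Apos, -x ∈ Apos → x = 0)
    (hgen : ∀ x : A, ∃ y ∈ Apos, ∃ z ∈ Apos, x = y - z)
    (hu : ∀ x ∈ Apos, x ≠ 0 → 0 < u x)
    (hcpt : IsCompact (states Apos u))
    (hfin : (Set.extremePoints ℝ (states Apos u)).Finite)
    (hT : ∀ f ∈ Set.extremePoints ℝ (effects Apos u),
      ∃ T : A →ₗ[ℝ] A, (∀ x ∈ Apos, T x ∈ Apos) ∧ u.comp T = f ∧
        ∀ ω ∈ states Apos u, f ω = 1 → T ω = ω) :
    ∀ F : Set A, IsFace (states Apos u) F → setDim F + 1 = setDim (states Apos u) →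
      ∃ a ∈ states Apos u, states Apos u = convexHull ℝ (F ∪ {a}) := by
  intro F hF hdim
  have hconv : Convex ℝ (states Apos u) := by
    intro x hx y hy a b ha hb hab
    exact ⟨hadd _ (hsmul x hx.1 a ha) _ (hsmul y hy.1 b hb), by simpa [hx.2, hy.2] using hab⟩
  have hzero : ∀ x ∈ Apos, u x = 0 → x = 0 := fun x hx hux => by
    by_contra hne
    exact (hu x hx hne).ne' hux
  obtain ⟨g₀, hg₀F, hg₀nonneg, ⟨w, hw, hg₀w⟩, hg₀ker⟩ :=
    exists_facet_functional hconv hF hdim u fun x hx => hx.2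
  obtain ⟨a, ha, hmax⟩ := hcpt.exists_isMaxOn ⟨w, hw⟩
    (LinearMap.continuous_of_finiteDimensional g₀).continuousOn
  have hg₀a : 0 < g₀ a := hg₀w.trans_le (hmax hw)
  obtain ⟨g, hgF, hg0, hg1, hga, hgker⟩ : ∃ g : Module.Dual ℝ A, (∀ x ∈ F, g x = 0) ∧
      (∀ x ∈ states Apos u, 0 ≤ g x) ∧ (∀ x ∈ states Apos u, g x ≤ 1) ∧ g a = 1 ∧
      ∀ e ∈ vectorSpan ℝ (states Apos u), g e = 0 → e ∈ vectorSpan ℝ F := by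
    refine ⟨(g₀ a)⁻¹ • g₀, fun x hx => by simp [hg₀F x hx], fun x hx => ?_, fun x hx => ?_,
      by simp [hg₀a.ne'], fun e he hge => hg₀ker e he ?_⟩
    · exact mul_nonneg (inv_nonneg.2 hg₀a.le) (hg₀nonneg x hx)
    · have : g₀ x ≤ g₀ a := hmax hx
      simpa [inv_mul_eq_div] using (div_le_one hg₀a).2 this
    · simpa [hg₀a.ne'] using hge
  obtain ⟨p, hp⟩ := hF.1
  have hpΩ := hF.2.2.1 hp
  have hgp := hgF p hp
  -- A linear map constant on `F` is determined on states by its values at `p` and `a`.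
  have hdec : ∀ ω ∈ states Apos u, ω - p - g ω • (a - p) ∈ vectorSpan ℝ F := fun ω hω =>
    hgker _ (Submodule.sub_mem _ (vsub_mem_vectorSpan ℝ hω hpΩ)
      (Submodule.smul_mem _ _ (vsub_mem_vectorSpan ℝ ha hpΩ))) (by simp [hga, hgp])
  have hpure : u - g ∈ Set.extremePoints ℝ (effects Apos u) := by
    have key : ∀ f₁ ∈ effects Apos u, ∀ f₂ ∈ effects Apos u, u - g ∈ openSegment ℝ f₁ f₂ →
        f₁ = u - g := by
      rintro f₁ h₁ f₂ h₂ ⟨s, t, hs, ht, hst, h⟩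
      have hx : ∀ x, s * f₁ x + t * f₂ x = u x - g x := fun x => by
        simpa using LinearMap.congr_fun h x
      have hF1 : ∀ x ∈ F, f₁ x = 1 := fun x hxF => by
        have hxΩ := hF.2.2.1 hxF
        have h3 := hx x
        rw [hxΩ.2, hgF x hxF] at h3
        nlinarith [h₁ x hxΩ, h₂ x hxΩ]
      have ha1 : f₁ a = 0 := by
        have h3 := hx a
        rw [ha.2, hga] at h3
        nlinarith [h₁ a ha, h₂ a ha]
      have hΩ : ∀ ω ∈ states Apos u, f₁ ω = (u - g) ω := fun ω hω => by
        have h3 : f₁ _ = 0 := vectorSpan_le_ker f₁ 1 hF1 (hdec ω hω)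
        simp only [map_sub, map_smul, hF1 p hp, ha1, smul_eq_mul] at h3
        rw [LinearMap.sub_apply, hω.2]
        linarith
      have hpos : ∀ x ∈ Apos, f₁ x = (u - g) x := fun x hx => by
        by_cases hx0 : x = 0
        · simp [hx0]
        · have hux := hu x hx hx0
          have h3 := hΩ ((u x)⁻¹ • x)
            ⟨hsmul x hx _ (inv_nonneg.2 hux.le), by simp [hux.ne']⟩
          simpa only [map_smul, smul_eq_mul, mul_right_inj' (inv_ne_zero hux.ne')] using h3
      ext x
      obtain ⟨y, hy, z, hz, rfl⟩ := hgen x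
      rw [map_sub, map_sub, hpos y hy, hpos z hz]
    refine ⟨fun ω hω => ?_, fun f₁ h₁ f₂ h₂ h => key f₁ h₁ f₂ h₂ h⟩
    rw [LinearMap.sub_apply, hω.2]
    constructor <;> linarith [hg0 ω hω, hg1 ω hω]
  obtain ⟨T, hTpos, hTu, hTfix⟩ := hT _ hpure
  have hTu' : ∀ x, u (T x) = u x - g x := fun x => LinearMap.congr_fun hTu x
  have hTF : ∀ x ∈ F, T x = x := fun x hx =>
    hTfix x (hF.2.2.1 hx) (by simp [(hF.2.2.1 hx).2, hgF x hx])
  have hTa : T a = 0 := hzero _ (hTpos a ha.1) (by rw [hTu', ha.2, hga, sub_self])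
  have hTω : ∀ ω ∈ states Apos u, T ω = ω - g ω • a := fun ω hω => by
    have h3 : (T - LinearMap.id : A →ₗ[ℝ] A) _ = 0 :=
      vectorSpan_le_ker (T - LinearMap.id) 0 (fun x hx => by simp [hTF x hx]) (hdec ω hω)
    simp only [LinearMap.sub_apply, LinearMap.id_apply, map_sub, map_smul, hTF p hp, hTa] at h3
    rw [← sub_eq_zero, ← h3]
    module
  refine ⟨a, ha, Subset.antisymm (fun ω hω => ?_) (convexHull_min ?_ hconv)⟩
  · have haH : a ∈ convexHull ℝ (F ∪ {a}) := subset_convexHull ℝ _ (by simp)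
    have hTmem := hTpos ω hω.1
    have hTuω : u (T ω) = 1 - g ω := by rw [hTu', hω.2]
    rcases (hg1 ω hω).eq_or_lt with h1 | h1
    · have h3 := hzero _ hTmem (by rw [hTuω, h1, sub_self])
      rw [hTω ω hω, h1, one_smul, sub_eq_zero] at h3
      rwa [h3]
    · have hpos : 0 < 1 - g ω := by linarith
      have hφ : (1 - g ω)⁻¹ • T ω ∈ states Apos u :=
        ⟨hsmul _ hTmem _ (inv_nonneg.2 hpos.le), by simp [hTuω, hpos.ne']⟩
      have hgφ : g ((1 - g ω)⁻¹ • T ω) = 0 := by simp [hTω ω hω, hga]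
      have hφF : (1 - g ω)⁻¹ • T ω ∈ F := by
        refine hF.mem_of_mem_affineSpan hφ ?_
        have h := hgker _ (vsub_mem_vectorSpan ℝ hφ hpΩ)
          (by rw [vsub_eq_sub, map_sub, hgφ, hgp, sub_self])
        rw [← direction_affineSpan] at h
        simpa using AffineSubspace.vadd_mem_of_mem_direction h (subset_affineSpan ℝ F hp)
      have hmem := convex_convexHull ℝ (F ∪ {a})
        (subset_convexHull ℝ _ (Or.inl hφF)) haH hpos.le (hg0 ω hω) (by ring)
      rwa [smul_inv_smul₀ hpos.ne', hTω ω hω, sub_add_cancel] at hmem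
  · exact union_subset hF.2.2.1 (singleton_subset_iff.2 ha)
end

section
/- Let (A, A₊, u_A) be an abstract state space whose set of normalized states Ω_A is a polytope. Assume the subspace principle: for every face Ω_S of Ω_A of the form Ω_S = {ω ∈ Ω_A : f(ω) = 1} for some extreme point f of E_A, the following holds, where S = span(Ω_S), S₊ = {αω : α ≥ 0, ω ∈ Ω_S}, u_S is the restriction of u_A to S and E_S = {e : S → ℝ linear : 0 ≤ e(ω) ≤ 1 for all ω ∈ Ω_S}: for every finite family e₁, …, eₙ of extreme points of E_S with e₁ + ⋯ + eₙ = u_S there exist extreme points f₁, …, f_{n+k} of E_A (for some k ≥ 0) with f₁ + ⋯ + f_{n+k} = u_A, the restriction of fᵢ to S equal to eᵢ for all i ≤ n, and {ω ∈ Ω_A : fᵢ(ω) = 1} = {ω ∈ Ω_S : eᵢ(ω) = 1} for all i ≤ n. Assume also the state discrimination principle: whenever Λ₁, Λ₂ ⊆ Ω_A and there exist e₁, e₂ ∈ E_A with e₁ + e₂ = u_A, e₁ = 1 on Λ₁ and e₁ = 0 on Λ₂, and whenever Λ₃, Λ₄ ⊆ Λ₂ and there exist g₁, g₂ ∈ E_A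 with g₁ + g₂ = u_A, g₁ = 1 on Λ₃ and g₁ = 0 on Λ₄, then there exist h₁, h₂, h₃ ∈ E_A with h₁ + h₂ + h₃ = u_A such that h₁ = 1 on Λ₁ and h₁ = 0 on Λ₃ ∪ Λ₄, h₂ = 1 on Λ₃ and h₂ = 0 on Λ₁ ∪ Λ₄, and h₃ = 1 on Λ₄ and h₃ = 0 on Λ₁ ∪ Λ₃. Then Ω_A is a simplex. -/
open Set

variable {A : Type*} [NormedAddCommGroup A] [NormedSpace ℝ A] [FiniteDimensional ℝ A]

/-- The set of effects of the abstract state space induced by a subset `ΩS` of the states,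
as linear functionals on the span `S` of `ΩS`. -/
def inducedEffects (ΩS : Set A) : Set (Module.Dual ℝ ↥(Submodule.span ℝ ΩS)) :=
  {e | ∀ σ : ↥(Submodule.span ℝ ΩS), (σ : A) ∈ ΩS → 0 ≤ e σ ∧ e σ ≤ 1}

section InducedEffects

variable {F V : Set A}

lemma mem_inducedEffects_of_comp (hF : F = convexHull ℝ V) (φ : Module.Dual ℝ A)
    (hφ : ∀ v ∈ V, 0 ≤ φ v ∧ φ v ≤ 1) :
    φ.comp (Submodule.span ℝ F).subtype ∈ inducedEffects F := by
  intro σ hσ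
  have hsub : convexHull ℝ V ⊆ φ ⁻¹' Icc 0 1 :=
    convexHull_min hφ ((convex_Icc (0 : ℝ) 1).linear_preimage φ)
  exact hsub (hF.subset hσ)

lemma exists_pos_forall_add_smul_mem {V : Set A} (hV : V.Finite) (φ d : Module.Dual ℝ A)
    (h : ∀ v ∈ V, (0 < φ v ∧ φ v < 1) ∨ ((0 ≤ φ v ∧ φ v ≤ 1) ∧ d v = 0)) :
    ∃ ε : ℝ, 0 < ε ∧ ∀ v ∈ V, (0 ≤ (φ + ε • d) v ∧ (φ + ε • d) v ≤ 1) ∧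
      0 ≤ (φ - ε • d) v ∧ (φ - ε • d) v ≤ 1 := by
  have key : ∀ᶠ ε in nhdsWithin (0 : ℝ) (Ioi 0), ∀ v ∈ V,
      (0 ≤ (φ + ε • d) v ∧ (φ + ε • d) v ≤ 1) ∧ 0 ≤ (φ - ε • d) v ∧ (φ - ε • d) v ≤ 1 := by
    refine (Filter.eventually_all_finite hV).2 fun v hv => ?_
    refine Filter.Eventually.filter_mono nhdsWithin_le_nhds ?_
    rcases h v hv with ⟨h0, h1⟩ | ⟨h01, hd⟩
    · have hp : Filter.Tendsto (fun ε : ℝ => φ v + ε * d v) (nhds 0) (nhds (φ v)) := by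
        have : Continuous fun ε : ℝ => φ v + ε * d v := by fun_prop
        simpa using this.tendsto 0
      have hm : Filter.Tendsto (fun ε : ℝ => φ v - ε * d v) (nhds 0) (nhds (φ v)) := by
        have : Continuous fun ε : ℝ => φ v - ε * d v := by fun_prop
        simpa using this.tendsto 0
      filter_upwards [hp.eventually (Icc_mem_nhds h0 h1), hm.eventually (Icc_mem_nhds h0 h1)]
        with ε hε hε'
      exact ⟨hε, hε'⟩
    · exact Filter.Eventually.of_forall fun ε => by simpa [hd] using h01
  obtain ⟨ε, hε, hpos⟩ := (key.and self_mem_nhdsWithin).exists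
  exact ⟨ε, hpos, hε⟩

/-- An extreme effect is determined by the vertices on which it is deterministic. -/
lemma subset_span_of_mem_extremePoints (hV : V.Finite) (hF : F = convexHull ℝ V)
    (φ : Module.Dual ℝ A)
    (hφ : φ.comp (Submodule.span ℝ F).subtype ∈ Set.extremePoints ℝ (inducedEffects F)) :
    F ⊆ Submodule.span ℝ {v ∈ V | φ v = 0 ∨ φ v = 1} := by
  intro p hp
  by_contra hnot
  obtain ⟨d, hdp, hd⟩ := Submodule.exists_le_ker_of_notMem hnot
  have hVF : V ⊆ F := hF ▸ subset_convexHull ℝ V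
  obtain ⟨ε, hε, hb⟩ := exists_pos_forall_add_smul_mem hV φ d fun v hv => by
    have hb : 0 ≤ φ v ∧ φ v ≤ 1 := hφ.1 ⟨v, Submodule.subset_span (hVF hv)⟩ (hVF hv)
    by_cases hdet : φ v = 0 ∨ φ v = 1
    · exact Or.inr ⟨hb, hd (Submodule.subset_span ⟨hv, hdet⟩)⟩
    · push Not at hdet
      exact Or.inl ⟨lt_of_le_of_ne hb.1 hdet.1.symm, lt_of_le_of_ne hb.2 hdet.2⟩
  have heq := hφ.2 (mem_inducedEffects_of_comp hF _ fun v hv => (hb v hv).1)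
    (mem_inducedEffects_of_comp hF _ fun v hv => (hb v hv).2)
    ⟨1 / 2, 1 / 2, by norm_num, by norm_num, by norm_num, by ext σ; simp; ring⟩
  have hval := LinearMap.congr_fun heq ⟨p, Submodule.subset_span hp⟩
  simp only [LinearMap.comp_apply, Submodule.subtype_apply, LinearMap.add_apply,
    LinearMap.smul_apply, smul_eq_mul, add_eq_left, mul_eq_zero] at hval
  exact hval.elim hε.ne' hdp

lemma exists_mem_extremePoints_inducedEffects (hV : V.Finite) (hF : F = convexHull ℝ V)
    (u : Module.Dual ℝ A) (hu : ∀ v ∈ V, u v = 1) {x y : A} (hx : x ∈ V) (hy : y ∈ V)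
    (hxy : x ≠ y) :
    ∃ φ : Module.Dual ℝ A, φ.comp (Submodule.span ℝ F).subtype ∈
      Set.extremePoints ℝ (inducedEffects F) ∧ φ x ≠ φ y := by
  have hVF : V ⊆ F := hF ▸ subset_convexHull ℝ V
  have := hV.to_subtype
  have := Fintype.ofFinite V
  let L : Module.Dual ℝ A →ₗ[ℝ] (V → ℝ) := LinearMap.pi fun v => Module.Dual.eval ℝ A v
  have hL : ∀ φ v, L φ v = φ v := fun _ _ => rfl
  let K : Set (V → ℝ) := (LinearMap.range L : Set (V → ℝ)) ∩ Icc 0 1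
  have hK : IsCompact K := isCompact_Icc.inter_left (Submodule.closed_of_finiteDimensional _)
  have hKc : Convex ℝ K := (LinearMap.range L).convex.inter (convex_Icc 0 1)
  obtain ⟨k, hk, hkxy⟩ : ∃ k ∈ Set.extremePoints ℝ K, k ⟨x, hx⟩ ≠ k ⟨y, hy⟩ := by
    by_contra! hall
    obtain ⟨d, hd⟩ : ∃ d : Module.Dual ℝ A, d (x - y) ≠ 0 := by
      by_contra! h
      exact hxy (sub_eq_zero.1 ((Module.forall_dual_apply_eq_zero_iff ℝ _).1 h))
    obtain ⟨ε, hε, hb⟩ := exists_pos_forall_add_smul_mem hV ((1 / 2 : ℝ) • u) d fun v hv =>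
      Or.inl (by simp [hu v hv]; norm_num)
    have hsub : K ⊆ {k | k ⟨x, hx⟩ = k ⟨y, hy⟩} := by
      rw [← closure_convexHull_extremePoints hK hKc]
      refine closure_minimal (convexHull_min hall ?_)
        (isClosed_eq (continuous_apply _) (continuous_apply _))
      intro a ha b hb s t _ _ _
      simp only [mem_ofPred_eq, Pi.add_apply, Pi.smul_apply] at *
      rw [ha, hb]
    have hmem : L ((1 / 2 : ℝ) • u + ε • d) ∈ K :=
      ⟨⟨_, rfl⟩, fun v => (hb v v.2).1.1, fun v => (hb v v.2).1.2⟩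
    have heq := hsub hmem
    simp only [mem_ofPred_eq, hL, LinearMap.add_apply, LinearMap.smul_apply, hu x hx, hu y hy,
      smul_eq_mul, add_right_inj] at heq
    exact hd (by rw [map_sub, sub_eq_zero]; exact mul_left_cancel₀ hε.ne' heq)
  obtain ⟨φ, rfl⟩ := hk.1.1
  have hext : ∀ e : Module.Dual ℝ (Submodule.span ℝ F), e ∈ inducedEffects F →
      ∃ ψ : Module.Dual ℝ A, ψ.comp (Submodule.span ℝ F).subtype = e ∧ L ψ ∈ K := by
    intro e he
    obtain ⟨ψ, hψ⟩ := LinearMap.exists_extend e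
    have hb : ∀ v : V, 0 ≤ ψ v ∧ ψ v ≤ 1 := fun v => by
      have := he ⟨v, Submodule.subset_span (hVF v.2)⟩ (hVF v.2)
      rwa [← hψ] at this
    exact ⟨ψ, hψ, ⟨ψ, rfl⟩, fun v => (hb v).1, fun v => (hb v).2⟩
  have hspan : Submodule.span ℝ F = Submodule.span ℝ V := by
    refine le_antisymm (Submodule.span_le.2 ?_) (Submodule.span_mono hVF)
    rw [hF]
    exact convexHull_min Submodule.subset_span (Submodule.span ℝ V).convex
  have hinj : ∀ φ ψ : Module.Dual ℝ A, L φ = L ψ →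
      φ.comp (Submodule.span ℝ F).subtype = ψ.comp (Submodule.span ℝ F).subtype := by
    intro φ ψ h
    ext ⟨p, hp⟩
    exact LinearMap.eqOn_span (fun v hv => congr_fun h ⟨v, hv⟩) (hspan ▸ hp)
  refine ⟨φ, ⟨mem_inducedEffects_of_comp hF φ fun v hv =>
    ⟨hk.1.2.1 ⟨v, hv⟩, hk.1.2.2 ⟨v, hv⟩⟩, ?_⟩, hkxy⟩
  intro e₁ he₁ e₂ he₂ hseg
  obtain ⟨ψ₁, rfl, hψ₁⟩ := hext e₁ he₁
  obtain ⟨ψ₂, rfl, hψ₂⟩ := hext e₂ he₂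
  obtain ⟨a, b, ha, hb, hab, hsum⟩ := hseg
  refine hinj _ _ (hk.2 hψ₁ hψ₂ ⟨a, b, ha, hb, hab, ?_⟩)
  ext v
  exact LinearMap.congr_fun hsum ⟨v, Submodule.subset_span (hVF v.2)⟩

lemma sub_mem_extremePoints_inducedEffects (u : Module.Dual ℝ A) (hu : ∀ ω ∈ F, u ω = 1)
    {h : Module.Dual ℝ (Submodule.span ℝ F)} (hh : h ∈ Set.extremePoints ℝ (inducedEffects F)) :
    u.comp (Submodule.span ℝ F).subtype - h ∈ Set.extremePoints ℝ (inducedEffects F) := by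
  have hcompl : ∀ e ∈ inducedEffects F,
      u.comp (Submodule.span ℝ F).subtype - e ∈ inducedEffects F := by
    intro e he σ hσ
    have hb := he σ hσ
    simp only [LinearMap.sub_apply, LinearMap.comp_apply, Submodule.subtype_apply, hu _ hσ]
    constructor <;> linarith
  refine ⟨hcompl h hh.1, ?_⟩
  rintro e₁ he₁ e₂ he₂ ⟨a, b, ha, hb, hab, hsum⟩
  have heq := hh.2 (hcompl _ he₁) (hcompl _ he₂) ⟨a, b, ha, hb, hab, by
    rw [smul_sub, smul_sub, sub_add_sub_comm, ← add_smul, hab, one_smul, hsum, sub_sub_cancel]⟩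
  rw [← heq, sub_sub_cancel]

end InducedEffects

section States

variable {Apos : Set A} {u : Module.Dual ℝ A}

lemma convex_states (hadd : ∀ x ∈ Apos, ∀ y ∈ Apos, x + y ∈ Apos)
    (hsmul : ∀ x ∈ Apos, ∀ c : ℝ, 0 ≤ c → c • x ∈ Apos) : Convex ℝ (states Apos u) := by
  intro x hx y hy a b ha hb hab
  exact ⟨hadd _ (hsmul x hx.1 a ha) _ (hsmul y hy.1 b hb), by simp [hx.2, hy.2, hab]⟩

lemma isExtreme_certain {f : Module.Dual ℝ A} (hf : f ∈ effects Apos u) :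
    IsExtreme ℝ (states Apos u) {ω ∈ states Apos u | f ω = 1} := by
  refine ⟨fun _ h => h.1, ?_⟩
  rintro x hx y hy z hz ⟨a, b, ha, hb, hab, rfl⟩
  refine ⟨hx, ?_⟩
  have h1 := hz.2
  simp only [map_add, map_smul, smul_eq_mul] at h1
  nlinarith [(hf x hx).2, (hf y hy).2]

lemma isFace_certain (hconv : Convex ℝ (states Apos u)) {f : Module.Dual ℝ A}
    (hf : f ∈ effects Apos u) (hne : {ω ∈ states Apos u | f ω = 1}.Nonempty) :
    IsFace (states Apos u) {ω ∈ states Apos u | f ω = 1} := by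
  refine ⟨hne, ?_, fun _ h => h.1, fun x hx y hy α h0 h1 hmem => ?_⟩
  · exact hconv.inter ((convex_singleton (1 : ℝ)).linear_preimage f)
  · have hseg : α • x + (1 - α) • y ∈ openSegment ℝ x y :=
      ⟨α, 1 - α, h0, by linarith, by ring, rfl⟩
    exact ⟨(isExtreme_certain hf).2 hx hy hmem hseg,
      (isExtreme_certain hf).2 hy hx hmem (openSegment_symm ℝ x y ▸ hseg)⟩

lemma certain_eq_convexHull (hconv : Convex ℝ (states Apos u)) (hcpt : IsCompact (states Apos u))
    (hfin : (Set.extremePoints ℝ (states Apos u)).Finite) {f : Module.Dual ℝ A}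
    (hf : f ∈ effects Apos u) :
    {ω ∈ states Apos u | f ω = 1} =
      convexHull ℝ {v ∈ Set.extremePoints ℝ (states Apos u) | f v = 1} := by
  have hcl : IsClosed (f ⁻¹' {1}) :=
    isClosed_singleton.preimage f.continuous_of_finiteDimensional
  have hext : Set.extremePoints ℝ {ω ∈ states Apos u | f ω = 1} =
      {v ∈ Set.extremePoints ℝ (states Apos u) | f v = 1} := by
    rw [(isExtreme_certain hf).extremePoints_eq]
    ext v
    exact ⟨fun h => ⟨h.2, h.1.2⟩, fun h => ⟨⟨h.1.1, h.2⟩, h.1⟩⟩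
  have hKM := closure_convexHull_extremePoints (hcpt.inter_right hcl)
    (hconv.inter ((convex_singleton (1 : ℝ)).linear_preimage f))
  change closure (convexHull ℝ (Set.extremePoints ℝ {ω ∈ states Apos u | f ω = 1})) =
    {ω ∈ states Apos u | f ω = 1} at hKM
  rw [hext, ((hfin.subset fun _ h => h.1).isClosed_convexHull ℝ).closure_eq] at hKM
  exact hKM.symm

lemma unit_sub_mem_effects {f : Module.Dual ℝ A} (hf : f ∈ effects Apos u) :
    u - f ∈ effects Apos u := by
  intro ω hω
  have hb := hf ω hω
  simp only [LinearMap.sub_apply, hω.2]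
  constructor <;> linarith

lemma unit_mem_effects : u ∈ effects Apos u := fun ω hω => by simp [hω.2]

lemma unit_mem_extremePoints_effects
    (hsmul : ∀ x ∈ Apos, ∀ c : ℝ, 0 ≤ c → c • x ∈ Apos)
    (hgen : ∀ x : A, ∃ y ∈ Apos, ∃ z ∈ Apos, x = y - z)
    (hu : ∀ x ∈ Apos, x ≠ 0 → 0 < u x) : u ∈ Set.extremePoints ℝ (effects Apos u) := by
  refine ⟨unit_mem_effects, ?_⟩
  rintro a ha b hb ⟨s, t, hs, ht, hst, hsum⟩
  have hstate : ∀ ω ∈ states Apos u, a ω = 1 := by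
    intro ω hω
    have h1 := LinearMap.congr_fun hsum ω
    simp only [LinearMap.add_apply, LinearMap.smul_apply, smul_eq_mul, hω.2] at h1
    nlinarith [(ha ω hω).2, (hb ω hω).2]
  have hpos : ∀ x ∈ Apos, a x = u x := by
    intro x hx
    by_cases h0 : x = 0
    · simp [h0]
    · have hux := hu x hx h0
      have h1 := hstate ((u x)⁻¹ • x) ⟨hsmul x hx _ (inv_nonneg.2 hux.le), by simp [hux.ne']⟩
      simp only [map_smul, smul_eq_mul] at h1
      field_simp at h1
      exact h1
  ext x
  obtain ⟨y, hy, z, hz, rfl⟩ := hgen x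
  simp [hpos y hy, hpos z hz]

end States

/-- The points of `V` can be perfectly identified by effects, one at a time. -/
def Identifiable (Apos : Set A) (u : Module.Dual ℝ A) (V : Set A) : Prop :=
  ∀ w ∈ V, ∃ g ∈ effects Apos u, g w = 1 ∧ ∀ v ∈ V, v ≠ w → g v = 0

section Identifiable

variable {Apos : Set A} {u : Module.Dual ℝ A} {V : Set A}

lemma Identifiable.linearIndependent (h : Identifiable Apos u V) :
    LinearIndependent ℝ (fun v : V => (v : A)) := by
  rw [linearIndependent_iff']
  intro s c hc i hi
  obtain ⟨g, -, hgi, hg⟩ := h i i.2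
  have h0 := congr_arg g hc
  rw [map_sum, Finset.sum_eq_single i] at h0
  · simpa [hgi] using h0
  · intro j _ hj
    simp [hg j j.2 (Subtype.coe_injective.ne hj)]
  · exact fun hi' => absurd hi hi'

lemma Identifiable.mem_convexHull (h : Identifiable Apos u V) (hV : V ⊆ states Apos u) {p : A}
    (hp : p ∈ states Apos u) (hspan : p ∈ Submodule.span ℝ V) : p ∈ convexHull ℝ V := by
  obtain ⟨c, hc, hsum⟩ := Submodule.mem_span_set.1 hspan
  have hval : ∀ w ∈ c.support, 0 ≤ c w := by
    intro w hw
    obtain ⟨g, hg, hgw, hgv⟩ := h w (hc hw)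
    have h0 := congr_arg g hsum
    rw [Finsupp.sum, map_sum, Finset.sum_eq_single w] at h0
    · simp only [map_smul, hgw, smul_eq_mul, mul_one] at h0
      exact h0 ▸ (hg p hp).1
    · intro v hv hne
      simp [hgv v (hc hv) hne]
    · exact fun h' => absurd hw h'
  have hone : ∑ w ∈ c.support, c w = 1 := by
    have h0 := congr_arg u hsum
    rw [Finsupp.sum, map_sum, hp.2] at h0
    rw [← h0]
    exact Finset.sum_congr rfl fun w hw => by simp [(hV (hc hw)).2]
  rw [← hsum]
  exact (convex_convexHull ℝ V).sum_mem hval hone fun w hw => subset_convexHull ℝ V (hc hw)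

end Identifiable

/-- The vertices of every certain face of an extreme effect are identifiable. -/
lemma identifiable_certain (Apos : Set A) (u : Module.Dual ℝ A)
    (hconv : Convex ℝ (states Apos u))
    (hcpt : IsCompact (states Apos u))
    (hfin : (Set.extremePoints ℝ (states Apos u)).Finite)
    (hsubspace : ∀ f ∈ Set.extremePoints ℝ (effects Apos u),
      IsFace (states Apos u) {ω ∈ states Apos u | f ω = 1} →
      ∀ n : ℕ,
      ∀ e : Fin n → Module.Dual ℝ ↥(Submodule.span ℝ {ω ∈ states Apos u | f ω = 1}),
        (∀ i, e i ∈ Set.extremePoints ℝ (inducedEffects {ω ∈ states Apos u | f ω = 1})) →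
        (∑ i, e i) = u.comp (Submodule.span ℝ {ω ∈ states Apos u | f ω = 1}).subtype →
        ∃ (k : ℕ) (g : Fin (n + k) → Module.Dual ℝ A),
          (∀ j, g j ∈ Set.extremePoints ℝ (effects Apos u)) ∧
          (∑ j, g j) = u ∧
          (∀ i : Fin n,
            (g (Fin.castAdd k i)).comp
                (Submodule.span ℝ {ω ∈ states Apos u | f ω = 1}).subtype = e i) ∧
          (∀ i : Fin n,
            {ω ∈ states Apos u | g (Fin.castAdd k i) ω = 1} =
              Subtype.val '' {σ : ↥(Submodule.span ℝ {ω ∈ states Apos u | f ω = 1}) |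
                (σ : A) ∈ {ω ∈ states Apos u | f ω = 1} ∧ e i σ = 1}))
    (hdiscr : ∀ Λ₁ Λ₂ Λ₃ Λ₄ : Set A, Λ₁ ⊆ states Apos u → Λ₂ ⊆ states Apos u →
      Λ₃ ⊆ Λ₂ → Λ₄ ⊆ Λ₂ →
      (∃ e₁ ∈ effects Apos u, ∃ e₂ ∈ effects Apos u, e₁ + e₂ = u ∧
        (∀ ω ∈ Λ₁, e₁ ω = 1) ∧ (∀ ω ∈ Λ₂, e₁ ω = 0)) →
      (∃ g₁ ∈ effects Apos u, ∃ g₂ ∈ effects Apos u, g₁ + g₂ = u ∧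
        (∀ ω ∈ Λ₃, g₁ ω = 1) ∧ (∀ ω ∈ Λ₄, g₁ ω = 0)) →
      ∃ h₁ ∈ effects Apos u, ∃ h₂ ∈ effects Apos u, ∃ h₃ ∈ effects Apos u,
        h₁ + h₂ + h₃ = u ∧
        (∀ ω ∈ Λ₁, h₁ ω = 1) ∧ (∀ ω ∈ Λ₃ ∪ Λ₄, h₁ ω = 0) ∧
        (∀ ω ∈ Λ₃, h₂ ω = 1) ∧ (∀ ω ∈ Λ₁ ∪ Λ₄, h₂ ω = 0) ∧
        (∀ ω ∈ Λ₄, h₃ ω = 1) ∧ (∀ ω ∈ Λ₁ ∪ Λ₃, h₃ ω = 0))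
    (f : Module.Dual ℝ A) (hf : f ∈ Set.extremePoints ℝ (effects Apos u)) :
    Identifiable Apos u {v ∈ Set.extremePoints ℝ (states Apos u) | f v = 1} := by
  induction hn : {v ∈ Set.extremePoints ℝ (states Apos u) | f v = 1}.ncard
    using Nat.strong_induction_on generalizing f with
  | _ n ih =>
  subst hn
  have hVfin : {v ∈ Set.extremePoints ℝ (states Apos u) | f v = 1}.Finite :=
    hfin.subset fun _ h => h.1
  have hF := certain_eq_convexHull hconv hcpt hfin hf.1
  by_cases hsing : {v ∈ Set.extremePoints ℝ (states Apos u) | f v = 1}.Subsingleton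
  · exact fun w hw => ⟨u, unit_mem_effects, hw.1.1.2, fun v hv hne => absurd (hsing hv hw) hne⟩
  obtain ⟨x, hx, y, hy, hxy⟩ := Set.not_subsingleton_iff.1 hsing
  obtain ⟨φ, hφ, hφxy⟩ := exists_mem_extremePoints_inducedEffects hVfin hF u
    (fun v hv => hv.1.1.2) hx hy hxy
  obtain ⟨k, g, hgext, -, hgres, hgcert⟩ := hsubspace f hf
    (isFace_certain hconv hf.1 ⟨x, hx.1.1, hx.2⟩) 2
    ![φ.comp (Submodule.span ℝ {ω ∈ states Apos u | f ω = 1}).subtype,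
      u.comp (Submodule.span ℝ {ω ∈ states Apos u | f ω = 1}).subtype -
        φ.comp (Submodule.span ℝ {ω ∈ states Apos u | f ω = 1}).subtype]
    (by
      rw [Fin.forall_fin_two]
      exact ⟨hφ, sub_mem_extremePoints_inducedEffects u (fun ω hω => hω.1.2) hφ⟩)
    (by simp)
  have hgφ : ∀ ω ∈ states Apos u, f ω = 1 → g (Fin.castAdd k 0) ω = φ ω := fun ω hω hfω =>
    LinearMap.congr_fun (hgres 0) ⟨ω, Submodule.subset_span ⟨hω, hfω⟩⟩
  have hcert₁ : ∀ ω ∈ states Apos u, g (Fin.castAdd k 0) ω = 1 ↔ f ω = 1 ∧ φ ω = 1 := by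
    intro ω hω
    constructor
    · intro h
      obtain ⟨σ, ⟨hσ, hσ1⟩, rfl⟩ := (hgcert 0).subset ⟨hω, h⟩
      exact ⟨hσ.2, hσ1⟩
    · rintro ⟨h1, h2⟩
      rw [hgφ ω hω h1, h2]
  have hcert₀ : ∀ ω ∈ states Apos u, g (Fin.castAdd k 1) ω = 1 ↔ f ω = 1 ∧ φ ω = 0 := by
    intro ω hω
    constructor
    · intro h
      obtain ⟨σ, ⟨hσ, hσ1⟩, rfl⟩ := (hgcert 1).subset ⟨hω, h⟩
      have : u (σ : A) - φ σ = 1 := hσ1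
      exact ⟨hσ.2, by linarith [hσ.1.2]⟩
    · rintro ⟨h1, h2⟩
      have : g (Fin.castAdd k 1) ω = u ω - φ ω :=
        LinearMap.congr_fun (hgres 1) ⟨ω, Submodule.subset_span ⟨hω, h1⟩⟩
      rw [this, h2, hω.2, sub_zero]
  have hV₁ : {v ∈ Set.extremePoints ℝ (states Apos u) | g (Fin.castAdd k 0) v = 1} =
      {v ∈ Set.extremePoints ℝ (states Apos u) | f v = 1 ∧ φ v = 1} :=
    Set.ext fun v => and_congr_right fun hv => hcert₁ v hv.1
  have hV₀ : {v ∈ Set.extremePoints ℝ (states Apos u) | g (Fin.castAdd k 1) v = 1} =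
      {v ∈ Set.extremePoints ℝ (states Apos u) | f v = 1 ∧ φ v = 0} :=
    Set.ext fun v => and_congr_right fun hv => hcert₀ v hv.1
  have hlt : ∀ c : ℝ, {v ∈ Set.extremePoints ℝ (states Apos u) | f v = 1 ∧ φ v = c}.ncard <
      {v ∈ Set.extremePoints ℝ (states Apos u) | f v = 1}.ncard := by
    intro c
    refine Set.ncard_lt_ncard (Set.ssubset_iff_subset_ne.2 ⟨fun v hv => ⟨hv.1, hv.2.1⟩, ?_⟩) hVfin
    intro heq
    exact hφxy ((heq.ge hx).2.2.trans (heq.ge hy).2.2.symm)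
  have hid₁ := ih _ (hV₁ ▸ hlt 1) _ (hgext _) rfl
  have hid₀ := ih _ (hV₀ ▸ hlt 0) _ (hgext _) rfl
  rw [hV₁] at hid₁
  rw [hV₀] at hid₀
  have hcombine : ∀ (e : Module.Dual ℝ A) (V W : Set A), e ∈ effects Apos u →
      V ⊆ states Apos u → W ⊆ states Apos u → (∀ v ∈ V, e v = 0) → (∀ w ∈ W, e w = 1) →
      Identifiable Apos u V → ∀ w ∈ V, ∃ h ∈ effects Apos u, h w = 1 ∧
        ∀ v ∈ V ∪ W, v ≠ w → h v = 0 := by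
    intro e V W he hV hW heV heW hid w hw
    obtain ⟨d, hd, hdw, hdv⟩ := hid w hw
    obtain ⟨-, -, h, hh, -, -, -, -, -, h1, h0, -⟩ :=
      hdiscr W V {w} (V \ {w}) hW hV (by simpa using hw) Set.sdiff_subset
        ⟨e, he, u - e, unit_sub_mem_effects he, by simp, heW, heV⟩
        ⟨d, hd, u - d, unit_sub_mem_effects hd, by simp, by simpa using hdw,
          fun v hv => hdv v hv.1 hv.2⟩
    refine ⟨h, hh, h1 w rfl, fun v hv hne => h0 v ?_⟩
    exact hv.elim (fun hv => Or.inr ⟨hv, hne⟩) Or.inl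
  have hg := (hgext (Fin.castAdd k 0)).1
  have hsub : ∀ c : ℝ, {v ∈ Set.extremePoints ℝ (states Apos u) | f v = 1 ∧ φ v = c} ⊆
      states Apos u := fun c v hv => hv.1.1
  have hval : ∀ c : ℝ, ∀ v ∈ {v ∈ Set.extremePoints ℝ (states Apos u) | f v = 1 ∧ φ v = c},
      g (Fin.castAdd k 0) v = c := fun c v hv => (hgφ v hv.1.1 hv.2.1).trans hv.2.2
  have hid : Identifiable Apos u
      ({v ∈ Set.extremePoints ℝ (states Apos u) | f v = 1 ∧ φ v = 0} ∪
        {v ∈ Set.extremePoints ℝ (states Apos u) | f v = 1 ∧ φ v = 1}) := by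
    rintro w (hw | hw)
    · exact hcombine _ _ _ hg (hsub 0) (hsub 1) (hval 0) (hval 1) hid₀ w hw
    · rw [Set.union_comm]
      exact hcombine (u - g (Fin.castAdd k 0)) _ _ (unit_sub_mem_effects hg) (hsub 1) (hsub 0)
        (fun v hv => by simp [hval 1 v hv, hv.1.1.2]) (fun v hv => by simp [hval 0 v hv, hv.1.1.2])
        hid₁ w hw
  have hcover : {v ∈ Set.extremePoints ℝ (states Apos u) | f v = 1} =
      {v ∈ Set.extremePoints ℝ (states Apos u) | f v = 1 ∧ φ v = 0} ∪
        {v ∈ Set.extremePoints ℝ (states Apos u) | f v = 1 ∧ φ v = 1} := by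
    refine Set.Subset.antisymm (fun v hv => ?_) ?_
    · have hspan := subset_span_of_mem_extremePoints hVfin hF φ hφ ⟨hv.1.1, hv.2⟩
      have hsplit : {v ∈ {v ∈ Set.extremePoints ℝ (states Apos u) | f v = 1} |
          φ v = 0 ∨ φ v = 1} =
          {v ∈ Set.extremePoints ℝ (states Apos u) | f v = 1 ∧ φ v = 0} ∪
          {v ∈ Set.extremePoints ℝ (states Apos u) | f v = 1 ∧ φ v = 1} := by
        ext v
        simp only [mem_ofPred_eq, mem_union]
        tauto
      rw [hsplit] at hspan
      have hstates := Set.union_subset (hsub 0) (hsub 1)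
      exact extremePoints_convexHull_subset
        (inter_extremePoints_subset_extremePoints_of_subset (convexHull_min hstates hconv)
          ⟨hid.mem_convexHull hstates hv.1.1 hspan, hv.1⟩)
    · rintro v (hv | hv) <;> exact ⟨hv.1, hv.2.1⟩
  rw [hcover]
  exact hid


/-- A polytopic abstract state space satisfying the subspace principle and the
state discrimination principle is classical: its set of normalized states is a simplex. -/
theorem polytopic_with_subspace_and_discrimination_is_simplex
    (Apos : Set A) (u : Module.Dual ℝ A)
    (hclosed : IsClosed Apos)
    (hadd : ∀ x ∈ Apos, ∀ y ∈ Apos, x + y ∈ Apos)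
    (hsmul : ∀ x ∈ Apos, ∀ c : ℝ, 0 ≤ c → c • x ∈ Apos)
    (hpointed : ∀ x ∈ Apos, -x ∈ Apos → x = 0)
    (hgen : ∀ x : A, ∃ y ∈ Apos, ∃ z ∈ Apos, x = y - z)
    (hu : ∀ x ∈ Apos, x ≠ 0 → 0 < u x)
    (hcpt : IsCompact (states Apos u))
    (hfin : (Set.extremePoints ℝ (states Apos u)).Finite)
    -- the subspace principle
    (hsubspace : ∀ f ∈ Set.extremePoints ℝ (effects Apos u),
      IsFace (states Apos u) {ω ∈ states Apos u | f ω = 1} →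
      ∀ n : ℕ,
      ∀ e : Fin n → Module.Dual ℝ ↥(Submodule.span ℝ {ω ∈ states Apos u | f ω = 1}),
        (∀ i, e i ∈ Set.extremePoints ℝ (inducedEffects {ω ∈ states Apos u | f ω = 1})) →
        (∑ i, e i) = u.comp (Submodule.span ℝ {ω ∈ states Apos u | f ω = 1}).subtype →
        ∃ (k : ℕ) (g : Fin (n + k) → Module.Dual ℝ A),
          (∀ j, g j ∈ Set.extremePoints ℝ (effects Apos u)) ∧
          (∑ j, g j) = u ∧
          (∀ i : Fin n,
            (g (Fin.castAdd k i)).comp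
                (Submodule.span ℝ {ω ∈ states Apos u | f ω = 1}).subtype = e i) ∧
          (∀ i : Fin n,
            {ω ∈ states Apos u | g (Fin.castAdd k i) ω = 1} =
              Subtype.val '' {σ : ↥(Submodule.span ℝ {ω ∈ states Apos u | f ω = 1}) |
                (σ : A) ∈ {ω ∈ states Apos u | f ω = 1} ∧ e i σ = 1}))
    -- the state discrimination principle
    (hdiscr : ∀ Λ₁ Λ₂ Λ₃ Λ₄ : Set A, Λ₁ ⊆ states Apos u → Λ₂ ⊆ states Apos u →
      Λ₃ ⊆ Λ₂ → Λ₄ ⊆ Λ₂ →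
      (∃ e₁ ∈ effects Apos u, ∃ e₂ ∈ effects Apos u, e₁ + e₂ = u ∧
        (∀ ω ∈ Λ₁, e₁ ω = 1) ∧ (∀ ω ∈ Λ₂, e₁ ω = 0)) →
      (∃ g₁ ∈ effects Apos u, ∃ g₂ ∈ effects Apos u, g₁ + g₂ = u ∧
        (∀ ω ∈ Λ₃, g₁ ω = 1) ∧ (∀ ω ∈ Λ₄, g₁ ω = 0)) →
      ∃ h₁ ∈ effects Apos u, ∃ h₂ ∈ effects Apos u, ∃ h₃ ∈ effects Apos u,
        h₁ + h₂ + h₃ = u ∧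
        (∀ ω ∈ Λ₁, h₁ ω = 1) ∧ (∀ ω ∈ Λ₃ ∪ Λ₄, h₁ ω = 0) ∧
        (∀ ω ∈ Λ₃, h₂ ω = 1) ∧ (∀ ω ∈ Λ₁ ∪ Λ₄, h₂ ω = 0) ∧
        (∀ ω ∈ Λ₄, h₃ ω = 1) ∧ (∀ ω ∈ Λ₁ ∪ Λ₃, h₃ ω = 0)) :
    AffineIndependent ℝ (fun e : Set.extremePoints ℝ (states Apos u) => (e : A)) := by
  have hid := identifiable_certain Apos u (convex_states hadd hsmul) hcpt hfin hsubspace hdiscr u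
    (unit_mem_extremePoints_effects hsmul hgen hu)
  have heq : {v ∈ Set.extremePoints ℝ (states Apos u) | u v = 1} =
      Set.extremePoints ℝ (states Apos u) :=
    Set.ext fun v => ⟨fun h => h.1, fun h => ⟨h, h.1.2⟩⟩
  rw [heq] at hid
  exact hid.linearIndependent.affineIndependent
end

section
/- Let (A, A₊, u_A) be an abstract state space (so that Ω_A is compact and spans A). If f is an extreme point of the set of effects E_A and f ≠ 0, then there exists a state ω ∈ Ω_A with f(ω) = 1. -/
open Set

variable {A : Type*} [NormedAddCommGroup A] [NormedSpace ℝ A] [FiniteDimensional ℝ A]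

/-- A nonzero pure effect attains the value `1` on some normalized state. -/
theorem nonzero_pure_effect_attains_one
    (Apos : Set A) (u : Module.Dual ℝ A)
    (hclosed : IsClosed Apos)
    (hadd : ∀ x ∈ Apos, ∀ y ∈ Apos, x + y ∈ Apos)
    (hsmul : ∀ x ∈ Apos, ∀ c : ℝ, 0 ≤ c → c • x ∈ Apos)
    (hpointed : ∀ x ∈ Apos, -x ∈ Apos → x = 0)
    (hgen : ∀ x : A, ∃ y ∈ Apos, ∃ z ∈ Apos, x = y - z)
    (hu : ∀ x ∈ Apos, x ≠ 0 → 0 < u x)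
    (hcpt : IsCompact (states Apos u))
    (hspan : Submodule.span ℝ (states Apos u) = ⊤)
    (f : Module.Dual ℝ A) (hf : f ∈ Set.extremePoints ℝ (effects Apos u)) (hf0 : f ≠ 0) :
    ∃ ω ∈ states Apos u, f ω = 1 := by
  rcases (states Apos u).eq_empty_or_nonempty with hempty | hne
  · refine absurd (LinearMap.ext_on (s := states Apos u) (g := 0) hspan ?_) hf0
    simp [hempty]
  obtain ⟨ω₀, hω₀, hmax⟩ :=
    hcpt.exists_isMaxOn hne f.continuous_of_finiteDimensional.continuousOn
  refine ⟨ω₀, hω₀, (hf.1 ω₀ hω₀).2.eq_of_not_lt fun hlt => hf0 ?_⟩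
  have hle : ∀ ω ∈ states Apos u, f ω ≤ f ω₀ := fun ω hω => hmax hω
  rcases (hf.1 ω₀ hω₀).1.eq_or_lt with hzero | hpos
  · refine LinearMap.ext_on hspan fun ω hω => ?_
    exact le_antisymm ((hle ω hω).trans hzero.ge) (hf.1 ω hω).1
  · have hscaled : (f ω₀)⁻¹ • f ∈ effects Apos u := fun ω hω => by
      rw [LinearMap.smul_apply, smul_eq_mul, inv_mul_eq_div]
      exact ⟨div_nonneg (hf.1 ω hω).1 hpos.le, div_le_one_of_le₀ (hle ω hω) hpos.le⟩
    have hzero_mem : (0 : Module.Dual ℝ A) ∈ effects Apos u := fun ω _ => by simp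
    have hseg : f ∈ openSegment ℝ 0 ((f ω₀)⁻¹ • f) :=
      ⟨1 - f ω₀, f ω₀, sub_pos.2 hlt, hpos, sub_add_cancel _ _, by
        rw [smul_zero, zero_add, smul_inv_smul₀ hpos.ne']⟩
    exact (hf.2 hzero_mem hscaled hseg).symm
end

section
/- Let V and W be finite-dimensional real vector spaces, let V₊ ⊆ V and W₊ ⊆ W be cones (i.e. V₊ + V₊ = V₊, αV₊ = V₊ for all α ≥ 0, and V₊ ∩ (−V₊) = {0}, and likewise for W₊), and assume that V₊ admits a base. Then the following are equivalent: (a) there exists an order isomorphism from V to W, i.e. a linear bijection φ : V → W such that for all v ∈ V, v ∈ V₊ if and only if φ(v) ∈ W₊; (b) dim V = dim W and there exist a base B_V of V₊ and a base B_W of W₊ together with a bijection B_V → B_W that extends to an affine map V → W (i.e. B_V and B_W are convex-isomorphic). -/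
open Set

/-- `B` is a base of the cone `K`: a nonempty convex subset of `K \ {0}` such that every
nonzero element of `K` is uniquely a positive multiple of an element of `B`. -/
def IsConeBase {V : Type*} [AddCommGroup V] [Module ℝ V] (K B : Set V) : Prop :=
  B.Nonempty ∧ Convex ℝ B ∧ B ⊆ K \ {0} ∧
    ∀ x ∈ K, x ≠ 0 → ∃! p : ℝ × V, 0 < p.1 ∧ p.2 ∈ B ∧ x = p.1 • p.2

section

variable {V W : Type*} [AddCommGroup V] [Module ℝ V] [AddCommGroup W] [Module ℝ W]

theorem IsConeBase.smul_eq_smul {K B : Set V} (hB : IsConeBase K B)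
    (hK : ∀ x ∈ K, ∀ c : ℝ, 0 ≤ c → c • x ∈ K) {s t : ℝ} {b c : V}
    (hs : 0 < s) (ht : 0 < t) (hb : b ∈ B) (hc : c ∈ B) (h : s • b = t • c) :
    s = t ∧ b = c := by
  obtain ⟨-, -, hsub, huniq⟩ := hB
  have := (huniq (s • b) (hK b (hsub hb).1 s hs.le) (smul_ne_zero hs.ne' (hsub hb).2)).unique
    (y₁ := (s, b)) (y₂ := (t, c)) ⟨hs, hb, rfl⟩ ⟨ht, hc, h⟩
  simpa using this

theorem IsConeBase.image {K B : Set V} (hB : IsConeBase K B) (e : V ≃ₗ[ℝ] W) :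
    IsConeBase (e '' K) (e '' B) := by
  obtain ⟨hne, hconv, hsub, huniq⟩ := hB
  refine ⟨hne.image e, hconv.linear_image e.toLinearMap, ?_, ?_⟩
  · rintro _ ⟨b, hb, rfl⟩
    exact ⟨mem_image_of_mem e (hsub hb).1, by simpa using (hsub hb).2⟩
  · rintro _ ⟨x, hx, rfl⟩ hx0
    obtain ⟨⟨s, b⟩, ⟨hs, hb, hsb⟩, hu⟩ := huniq x hx (by simpa using hx0)
    refine ⟨(s, e b), ⟨hs, mem_image_of_mem e hb, by simp [hsb]⟩, ?_⟩
    rintro ⟨t, _⟩ ⟨ht, ⟨c, hc, rfl⟩, htc⟩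
    have := hu (t, c) ⟨ht, hc, e.injective (by simpa using htc)⟩
    simp_all

/-- A linear relation between two spaces of equal finite dimension that is injective in both
directions is contained in the graph of a linear equivalence. -/
theorem Submodule.exists_linearEquiv_of_injective_relation [FiniteDimensional ℝ V]
    [FiniteDimensional ℝ W] (hdim : Module.finrank ℝ V = Module.finrank ℝ W)
    (G : Submodule ℝ (V × W)) (hG : ∀ p ∈ G, p.1 = 0 ↔ p.2 = 0) :
    ∃ e : V ≃ₗ[ℝ] W, ∀ p ∈ G, e p.1 = p.2 := by
  let e₀ := LinearEquiv.ofFinrankEq V W hdim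
  let f : G →ₗ[ℝ] V := LinearMap.fst ℝ V W ∘ₗ G.subtype
  let g : G →ₗ[ℝ] V := e₀.symm.toLinearMap ∘ₗ LinearMap.snd ℝ V W ∘ₗ G.subtype
  have hf : Function.Injective f := by
    rw [injective_iff_map_eq_zero]
    rintro ⟨p, hp⟩ h
    exact Subtype.ext (Prod.ext h ((hG p hp).1 h))
  have hg : Function.Injective g := by
    rw [injective_iff_map_eq_zero]
    rintro ⟨p, hp⟩ h
    have h2 : p.2 = 0 := e₀.symm.injective (by simpa [g] using h)
    exact Subtype.ext (Prod.ext ((hG p hp).2 h2) h2)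
  obtain ⟨u, hu⟩ := Submodule.exists_linearEquiv_restrict_eq
    ((LinearEquiv.ofInjective f hf).symm ≪≫ₗ LinearEquiv.ofInjective g hg)
  refine ⟨u ≪≫ₗ e₀, fun p hp => ?_⟩
  have h := hu (LinearEquiv.ofInjective f hf ⟨p, hp⟩)
  rw [LinearEquiv.trans_apply, LinearEquiv.symm_apply_apply] at h
  have h' : e₀.symm p.2 = u p.1 := h
  simp [← h']

theorem AffineMap.exists_smul_add_smul_eq {B : Set V} (hB : Convex ℝ B) (φ : V →ᵃ[ℝ] W)
    {s t : ℝ} (hs : 0 < s) (ht : 0 < t) {b c : V} (hb : b ∈ B) (hc : c ∈ B) :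
    ∃ d ∈ B, s • b + t • c = (s + t) • d ∧ s • φ b + t • φ c = (s + t) • φ d := by
  have hst : s + t ≠ 0 := by positivity
  have hsum : s / (s + t) + t / (s + t) = 1 := by field_simp
  refine ⟨(s / (s + t)) • b + (t / (s + t)) • c,
    hB hb hc (by positivity) (by positivity) hsum, ?_, ?_⟩
  · simp only [smul_add, smul_smul, mul_div_cancel₀ _ hst]
  · rw [Convex.combo_affine_apply hsum]
    simp only [smul_add, smul_smul, mul_div_cancel₀ _ hst]

theorem AffineMap.exists_of_mem_span_graph {B : Set V} (hB : Convex ℝ B) (hne : B.Nonempty)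
    (φ : V →ᵃ[ℝ] W) {p : V × W} (hp : p ∈ Submodule.span ℝ ((fun b => (b, φ b)) '' B)) :
    ∃ s t : ℝ, 0 < s ∧ 0 < t ∧ ∃ b ∈ B, ∃ c ∈ B,
      p.1 = s • b - t • c ∧ p.2 = s • φ b - t • φ c := by
  obtain ⟨b₀, hb₀⟩ := hne
  induction hp using Submodule.span_induction with
  | mem x hx =>
    obtain ⟨b, hb, rfl⟩ := hx
    exact ⟨2, 1, by norm_num, by norm_num, b, hb, b, hb, by module, by module⟩
  | zero => exact ⟨1, 1, by norm_num, by norm_num, b₀, hb₀, b₀, hb₀, by simp, by simp⟩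
  | add x y _ _ hx hy =>
    obtain ⟨s, t, hs, ht, b, hb, c, hc, hx1, hx2⟩ := hx
    obtain ⟨s', t', hs', ht', b', hb', c', hc', hy1, hy2⟩ := hy
    obtain ⟨d, hd, hd1, hd2⟩ := φ.exists_smul_add_smul_eq hB hs hs' hb hb'
    obtain ⟨k, hk, hk1, hk2⟩ := φ.exists_smul_add_smul_eq hB ht ht' hc hc'
    refine ⟨s + s', t + t', by positivity, by positivity, d, hd, k, hk, ?_, ?_⟩
    · rw [Prod.fst_add, hx1, hy1, ← hd1, ← hk1]; abel
    · rw [Prod.snd_add, hx2, hy2, ← hd2, ← hk2]; abel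
  | smul r x _ hx =>
    obtain ⟨s, t, hs, ht, b, hb, c, hc, hx1, hx2⟩ := hx
    rcases lt_trichotomy r 0 with hr | rfl | hr
    · refine ⟨-r * t, -r * s, mul_pos (neg_pos.2 hr) ht, mul_pos (neg_pos.2 hr) hs,
        c, hc, b, hb, ?_, ?_⟩
      · rw [Prod.smul_fst, hx1]; module
      · rw [Prod.smul_snd, hx2]; module
    · exact ⟨1, 1, by norm_num, by norm_num, b₀, hb₀, b₀, hb₀, by simp, by simp⟩
    · refine ⟨r * s, r * t, by positivity, by positivity, b, hb, c, hc, ?_, ?_⟩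
      · rw [Prod.smul_fst, hx1]; module
      · rw [Prod.smul_snd, hx2]; module

theorem IsConeBase.exists_linearEquiv_eqOn [FiniteDimensional ℝ V] [FiniteDimensional ℝ W]
    (hdim : Module.finrank ℝ V = Module.finrank ℝ W) {K B : Set V} {L C : Set W}
    (hK : ∀ x ∈ K, ∀ c : ℝ, 0 ≤ c → c • x ∈ K) (hL : ∀ x ∈ L, ∀ c : ℝ, 0 ≤ c → c • x ∈ L)
    (hB : IsConeBase K B) (hC : IsConeBase L C) (φ : V →ᵃ[ℝ] W) (hφ : BijOn φ B C) :
    ∃ e : V ≃ₗ[ℝ] W, EqOn e φ B := by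
  obtain ⟨e, he⟩ := Submodule.exists_linearEquiv_of_injective_relation hdim
    (Submodule.span ℝ ((fun b => (b, φ b)) '' B)) (by
      intro p hp
      obtain ⟨s, t, hs, ht, b, hb, c, hc, h1, h2⟩ :=
        φ.exists_of_mem_span_graph hB.2.1 hB.1 hp
      rw [h1, h2, sub_eq_zero, sub_eq_zero]
      constructor <;> intro h
      · obtain ⟨rfl, rfl⟩ := hB.smul_eq_smul hK hs ht hb hc h
        rfl
      · obtain ⟨rfl, hbc⟩ := hC.smul_eq_smul hL hs ht (hφ.mapsTo hb) (hφ.mapsTo hc) h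
        rw [hφ.injOn hb hc hbc])
  exact ⟨e, fun b hb => he _ (Submodule.subset_span (mem_image_of_mem _ hb))⟩

theorem IsConeBase.subset_of_subset {K B L : Set V} (hB : IsConeBase K B) (hBL : B ⊆ L)
    (hL : ∀ x ∈ L, ∀ c : ℝ, 0 ≤ c → c • x ∈ L) : K ⊆ L := by
  intro x hx
  rcases eq_or_ne x 0 with rfl | hx0
  · obtain ⟨b, hb⟩ := hB.1
    simpa using hL b (hBL hb) 0 le_rfl
  · obtain ⟨⟨s, b⟩, ⟨hs, hb, rfl⟩, -⟩ := hB.2.2.2 x hx hx0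
    exact hL b (hBL hb) s hs.le

end

/-- Two finite-dimensional ordered vector spaces (given by cones `V₊`, `W₊`,
where `V₊` admits a base) are order-isomorphic if and only if they have the same dimension and
there are bases of the two cones which are convex-isomorphic (related by a bijection that
extends to an affine map). -/
theorem order_isomorphic_iff_convex_isomorphic_bases
    {V W : Type*} [AddCommGroup V] [Module ℝ V] [FiniteDimensional ℝ V]
    [AddCommGroup W] [Module ℝ W] [FiniteDimensional ℝ W]
    (Vpos : Set V) (Wpos : Set W)
    (hVadd : ∀ x ∈ Vpos, ∀ y ∈ Vpos, x + y ∈ Vpos)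
    (hVsmul : ∀ x ∈ Vpos, ∀ c : ℝ, 0 ≤ c → c • x ∈ Vpos)
    (hVpointed : ∀ x ∈ Vpos, -x ∈ Vpos → x = 0)
    (hVne : Vpos.Nonempty)
    (hWadd : ∀ x ∈ Wpos, ∀ y ∈ Wpos, x + y ∈ Wpos)
    (hWsmul : ∀ x ∈ Wpos, ∀ c : ℝ, 0 ≤ c → c • x ∈ Wpos)
    (hWpointed : ∀ x ∈ Wpos, -x ∈ Wpos → x = 0)
    (hWne : Wpos.Nonempty)
    (hbase : ∃ B, IsConeBase Vpos B) :
    (∃ φ : V ≃ₗ[ℝ] W, ∀ v : V, v ∈ Vpos ↔ φ v ∈ Wpos) ↔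
      (Module.finrank ℝ V = Module.finrank ℝ W ∧
        ∃ (BV : Set V) (BW : Set W), IsConeBase Vpos BV ∧ IsConeBase Wpos BW ∧
          ∃ φ : V →ᵃ[ℝ] W, Set.BijOn φ BV BW) := by
  constructor
  · rintro ⟨φ, hφ⟩
    obtain ⟨B, hB⟩ := hbase
    have himage : φ '' Vpos = Wpos := by
      ext w
      refine ⟨?_, fun hw => ⟨φ.symm w, (hφ _).2 (by simpa using hw), by simp⟩⟩
      rintro ⟨v, hv, rfl⟩
      exact (hφ v).1 hv
    exact ⟨φ.finrank_eq, B, φ '' B, hB, himage ▸ hB.image φ, φ.toLinearMap.toAffineMap,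
      φ.injective.injOn.bijOn_image⟩
  · rintro ⟨hdim, B, C, hB, hC, φ, hφ⟩
    obtain ⟨e, he⟩ := hB.exists_linearEquiv_eqOn hdim hVsmul hWsmul hC φ hφ
    have hVW : Vpos ⊆ e ⁻¹' Wpos := by
      refine hB.subset_of_subset (fun b hb => ?_) fun x hx c hc => ?_
      · rw [mem_preimage, he hb]
        exact (hC.2.2.1 (hφ.mapsTo hb)).1
      · rw [mem_preimage, map_smul]
        exact hWsmul _ hx c hc
    have hWV : Wpos ⊆ e.symm ⁻¹' Vpos := by
      refine hC.subset_of_subset (fun c hc => ?_) fun x hx c hc => ?_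
      · obtain ⟨b, hb, rfl⟩ := hφ.surjOn hc
        rw [mem_preimage, ← he hb, e.symm_apply_apply]
        exact (hB.2.2.1 hb).1
      · rw [mem_preimage, map_smul]
        exact hVsmul _ hx c hc
    exact ⟨e, fun v => ⟨fun hv => hVW hv, fun hv => by simpa using hWV hv⟩⟩
end
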